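/- arXiv:1502.07930 — 5 statements merged into one kernel-verified Lean document; each statement's English description precedes it below -/
import Mathlib

section
/- Let α, μ be real numbers with 0 ≤ α ≤ 1 and μ ≥ 0. Then for every real number λ, the maximum of the two quantities (1 − α)·(1 + λ·μ) and (2 − α·(1 − λ) − λ)/2 is at least 1 − α·(1 + μ)/(1 + 2·μ). -/
/-- Elimination of λ: for `0 ≤ α ≤ 1`, `μ ≥ 0` and every real λ, the maximum of
`(1 − α)·(1 + λ·μ)` and `(2 − α·(1 − λ) − λ)/2` is at least `1 − α·(1 + μ)/(1 + 2·μ)`. -/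
theorem elimination_of_lambda (α μ : ℝ) (hα0 : 0 ≤ α) (hα1 : α ≤ 1) (hμ : 0 ≤ μ) :
    ∀ l : ℝ,
      1 - α * (1 + μ) / (1 + 2 * μ) ≤
        max ((1 - α) * (1 + l * μ)) ((2 - α * (1 - l) - l) / 2) := by
  intro l
  have hp : 0 < 1 + 2 * μ := by linarith
  have h1 := le_max_left ((1 - α) * (1 + l * μ)) ((2 - α * (1 - l) - l) / 2)
  have h2 := le_max_right ((1 - α) * (1 + l * μ)) ((2 - α * (1 - l) - l) / 2)
  generalize max ((1 - α) * (1 + l * μ)) ((2 - α * (1 - l) - l) / 2) = M at *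
  have h3 := mul_le_mul_of_nonneg_left h2 (by linarith : 0 ≤ 2 * μ)
  rw [sub_le_comm, le_div_iff₀ hp]
  linarith
end

section
/- Let α, μ be real numbers with α ≥ 0 and 0 < μ ≤ 1. Then for all real numbers ζ and β₁, the maximum of the two quantities (2 − β₁)·α + (1 − μ)·ζ·α/μ and (1 + α − ζ·α)/2 is at least ((1 − μ) + α·(1 + μ − μ·β₁))/(2 − μ). -/
/-- Elimination of ζ: for `α ≥ 0`, `0 < μ ≤ 1` and all real ζ and β₁, the maximum of
`(2 − β₁)·α + (1 − μ)·ζ·α/μ` and `(1 + α − ζ·α)/2` is at least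
`((1 − μ) + α·(1 + μ − μ·β₁))/(2 − μ)`. -/
theorem elimination_of_zeta (α μ : ℝ) (hα : 0 ≤ α) (hμ0 : 0 < μ) (hμ1 : μ ≤ 1) :
    ∀ ζ β₁ : ℝ,
      ((1 - μ) + α * (1 + μ - μ * β₁)) / (2 - μ) ≤
        max ((2 - β₁) * α + (1 - μ) * ζ * α / μ) ((1 + α - ζ * α) / 2) := by
  intro ζ β₁
  have h2 : 0 < 2 - μ := by linarith
  rw [div_le_iff₀ h2]
  have hA := le_max_left ((2 - β₁) * α + (1 - μ) * ζ * α / μ) ((1 + α - ζ * α) / 2)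
  have hB := le_max_right ((2 - β₁) * α + (1 - μ) * ζ * α / μ) ((1 + α - ζ * α) / 2)
  have hA' := mul_le_mul_of_nonneg_left hA hμ0.le
  have hB' := mul_le_mul_of_nonneg_left hB (by linarith : 0 ≤ 2 * (1 - μ))
  have e : μ * ((2 - β₁) * α + (1 - μ) * ζ * α / μ)
      = μ * ((2 - β₁) * α) + (1 - μ) * ζ * α := by
    field_simp
  rw [e] at hA'
  linarith
end

section
/- Let α, μ be real numbers with α ≥ 0 and 0 ≤ μ ≤ 1. Then for every real number β₁, the maximum of the two quantities 1 − α + β₁·α and ((1 − μ) + α·(1 + μ − μ·β₁))/(2 − μ) is at least (1 + α)/2. -/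
/-- First elimination of β₁: for `α ≥ 0`, `0 ≤ μ ≤ 1` and every real β₁, the maximum of
`1 − α + β₁·α` and `((1 − μ) + α·(1 + μ − μ·β₁))/(2 − μ)` is at least `(1 + α)/2`. -/
theorem first_elimination_of_beta1 (α μ : ℝ) (hα : 0 ≤ α) (hμ0 : 0 ≤ μ) (hμ1 : μ ≤ 1) :
    ∀ β₁ : ℝ,
      (1 + α) / 2 ≤
        max (1 - α + β₁ * α) (((1 - μ) + α * (1 + μ - μ * β₁)) / (2 - μ)) := by
  intro β₁
  rw [le_max_iff]
  by_cases h : (1 + α) / 2 ≤ 1 - α + β₁ * α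
  · exact Or.inl h
  · right
    have h' := not_le.mp h
    rw [le_div_iff₀ (by linarith)]
    have := mul_nonneg hμ0 (sub_nonneg.mpr h'.le)
    linarith
end

section
/- Let α, β₁, γ, θ, ζ, λ, μ be real numbers, each in the interval [0, 1], with μ > 0. Then the maximum of the following eight quantities is at least 7/10: (i) 1 − α + β₁·α; (ii) α + γ·(1 − α); (iii) 1 − α + α·θ; (iv) 1 − λ·(1 − α) − α·θ; (v) (1 − α)·(1 + λ·μ); (vi) 1 − ζ·α − γ·(1 − α); (vii) (2 − β₁)·α + (1 − μ)·ζ·α/μ; (viii) ((1 − μ) + α·(2 + μ) − α·β₁)/2 + (1 − 2·μ)·ζ·α/(2·μ). -/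
/-- Analytic core of the 0.7-approximation theorem: for parameters
α, β₁, γ, θ, ζ, λ, μ in `[0, 1]` with `μ > 0`, the maximum of the eight lower
bounds on the ratios of the five solutions is at least `7/10`. -/
theorem main_ratio_bound (α β₁ γ θ ζ l μ : ℝ)
    (hα0 : 0 ≤ α) (hα1 : α ≤ 1)
    (hβ0 : 0 ≤ β₁) (hβ1 : β₁ ≤ 1)
    (hγ0 : 0 ≤ γ) (hγ1 : γ ≤ 1)
    (hθ0 : 0 ≤ θ) (hθ1 : θ ≤ 1)
    (hζ0 : 0 ≤ ζ) (hζ1 : ζ ≤ 1)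
    (hl0 : 0 ≤ l) (hl1 : l ≤ 1)
    (hμ0 : 0 < μ) (hμ1 : μ ≤ 1) :
    7 / 10 ≤
      max (1 - α + β₁ * α)
        (max (α + γ * (1 - α))
          (max (1 - α + α * θ)
            (max (1 - l * (1 - α) - α * θ)
              (max ((1 - α) * (1 + l * μ))
                (max (1 - ζ * α - γ * (1 - α))
                  (max ((2 - β₁) * α + (1 - μ) * ζ * α / μ)
                    (((1 - μ) + α * (2 + μ) - α * β₁) / 2 +
                      (1 - 2 * μ) * ζ * α / (2 * μ)))))))) := by
  by_contra hcon
  simp only [not_le, max_lt_iff] at hcon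
  obtain ⟨h1, h2, h3, h4, h5, h6, h7, h8⟩ := hcon
  have hζα : 0 ≤ ζ * α := mul_nonneg hζ0 hα0
  have e7 : 0 ≤ (1 - μ) * ζ * α / μ := by
    apply div_nonneg _ hμ0.le
    rw [mul_assoc]
    exact mul_nonneg (by linarith) hζα
  have ha : α < 4 / 10 := by linarith
  have hL : 6 / 10 - α < l * (1 - α) := by linarith
  have hLμ : (6 / 10 - α) * μ < l * (1 - α) * μ := mul_lt_mul_of_pos_right hL hμ0
  have h5' : (6 / 10 - α) * μ < α - 3 / 10 := by linarith
  have hμ : μ < 1 / 2 := by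
    by_contra hc
    have := mul_nonneg (show (0 : ℝ) ≤ 6 / 10 - α by linarith) (sub_nonneg.2 (not_lt.1 hc))
    linarith
  have e8 : 0 ≤ (1 - 2 * μ) * ζ * α / (2 * μ) := by
    apply div_nonneg _ (by linarith)
    rw [mul_assoc]
    exact mul_nonneg (by linarith) hζα
  have h8' : α - 1 / 10 < μ * (1 - α) := by linarith
  have p1 := mul_lt_mul_of_pos_right h8' (show (0 : ℝ) < 6 / 10 - α by linarith)
  have p2 := mul_lt_mul_of_pos_right h5' (show (0 : ℝ) < 1 - α by linarith)
  linarith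
end

section
/- Let G be a simple graph on a finite vertex set V with a bipartition (V₁, V₂), i.e., every edge of G has one endpoint in V₁ and one endpoint in V₂. Suppose that every vertex of V₁ has degree d₁ and every vertex of V₂ has degree d₂, with d₂ ≤ d₁, and let k ≤ |V₁|. Then: (a) every subset K ⊆ V₁ with |K| = k covers exactly k·d₁ edges of G; and (b) every subset K ⊆ V with |K| = k covers at most k·d₁ edges of G. Consequently, any k-element subset of V₁ is an optimal solution of max k-vertex cover on G. -/
open Finset

/-- Max k-vertex cover is trivial on semi-regular bipartite graphs: if every
vertex of `V₁` has degree `d₁`, every vertex of `V₂` has degree `d₂ ≤ d₁`, and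
`k ≤ |V₁|`, then (a) every `k`-subset of `V₁` covers exactly `k·d₁` edges,
(b) every `k`-subset of the vertices covers at most `k·d₁` edges, and hence
(c) every `k`-subset of `V₁` is an optimal solution of max k-vertex cover. -/
theorem semiregular_bipartite_max_kVC {V : Type*} [Fintype V] [DecidableEq V]
    (G : SimpleGraph V) [DecidableRel G.Adj]
    (V₁ V₂ : Finset V) (hdisj : Disjoint V₁ V₂) (hunion : V₁ ∪ V₂ = Finset.univ)
    (hbip : ∀ u v : V, G.Adj u v → (u ∈ V₁ ∧ v ∈ V₂) ∨ (u ∈ V₂ ∧ v ∈ V₁))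
    (d₁ d₂ : ℕ) (hd₁ : ∀ v ∈ V₁, G.degree v = d₁) (hd₂ : ∀ v ∈ V₂, G.degree v = d₂)
    (hdle : d₂ ≤ d₁) (k : ℕ) (hk : k ≤ V₁.card) :
    (∀ K : Finset V, K ⊆ V₁ → K.card = k →
        (G.edgeFinset.filter fun e => ∃ v ∈ K, v ∈ e).card = k * d₁) ∧
    (∀ K : Finset V, K.card = k →
        (G.edgeFinset.filter fun e => ∃ v ∈ K, v ∈ e).card ≤ k * d₁) ∧
    (∀ K : Finset V, K ⊆ V₁ → K.card = k → ∀ K' : Finset V, K'.card = k →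
        (G.edgeFinset.filter fun e => ∃ v ∈ K', v ∈ e).card ≤
          (G.edgeFinset.filter fun e => ∃ v ∈ K, v ∈ e).card) := by
  have key : ∀ K : Finset V, (G.edgeFinset.filter fun e => ∃ v ∈ K, v ∈ e)
      = K.biUnion fun v => G.incidenceFinset v := by
    intro K
    ext e
    simp only [mem_filter, mem_biUnion, SimpleGraph.incidenceFinset_eq_filter]
    tauto
  have ha : ∀ K : Finset V, K ⊆ V₁ → K.card = k →
      (G.edgeFinset.filter fun e => ∃ v ∈ K, v ∈ e).card = k * d₁ := by
    intro K hK hc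
    rw [key, card_biUnion]
    · rw [← hc, ← smul_eq_mul, ← sum_const]
      refine sum_congr rfl fun v hv => ?_
      rw [SimpleGraph.card_incidenceFinset_eq_degree, hd₁ v (hK hv)]
    · intro u hu v hv huv
      rw [Function.onFun, Finset.disjoint_left]
      intro e he he'
      rw [SimpleGraph.incidenceFinset_eq_filter, mem_filter, SimpleGraph.mem_edgeFinset] at he he'
      have h := (Sym2.mem_and_mem_iff huv).1 ⟨he.2, he'.2⟩
      have hadj : G.Adj u v := by
        have := he.1
        rwa [h, SimpleGraph.mem_edgeSet] at this
      rcases hbip u v hadj with h | h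
      · exact Finset.disjoint_left.1 hdisj (hK hv) h.2
      · exact Finset.disjoint_left.1 hdisj (hK hu) h.1
  have hb : ∀ K : Finset V, K.card = k →
      (G.edgeFinset.filter fun e => ∃ v ∈ K, v ∈ e).card ≤ k * d₁ := by
    intro K hc
    rw [key, ← hc]
    refine card_biUnion_le_card_mul _ _ _ fun v hv => ?_
    rw [SimpleGraph.card_incidenceFinset_eq_degree]
    have : v ∈ V₁ ∪ V₂ := hunion ▸ mem_univ v
    rcases mem_union.1 this with h | h
    · exact (hd₁ v h).le
    · exact (hd₂ v h).le.trans hdle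
  refine ⟨ha, hb, fun K hK hc K' hc' => ?_⟩
  rw [ha K hK hc]
  exact hb K' hc'
end
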